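/- arXiv:2006.10372 — 3 statements merged into one kernel-verified Lean document; each statement's English description precedes it below -/
import Mathlib

section
/- Let Z ∈ B(H) be a bounded invertible operator with Z P_k = P_k Z for every k and Z P_0 = P_0. Then there exist a unitary operator U ∈ B(H) with U P_k = P_k U for every k, and a bounded invertible positive operator Z' ∈ B(H) with Z' P_k = P_k Z' for every k and Z' P_0 = P_0, such that U* (Z S_i) U = Z' S_i for every letter i ∈ {1,…,d}. -/
noncomputable section

instance (α : Type*) [DecidableEq α] : DecidableEq (FreeMonoid α) :=
  fun a b => inferInstanceAs (Decidable (a.toList = b.toList))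

/-- The full Fock space of `ℂ^d`, modeled as `ℓ²` of the free monoid on `Fin d`. -/
abbrev FockSpace (d : ℕ) : Type := lp (fun _ : FreeMonoid (Fin d) => ℂ) 2

/-- The standard basis vector `e_α` of the Fock space. -/
noncomputable def fockBasis (d : ℕ) (α : FreeMonoid (Fin d)) : FockSpace d :=
  lp.single 2 α (1 : ℂ)

/-- `S_α = S_{α₁} ⋯ S_{αₙ}` for a word `α` (with `S_∅ = 1`). -/
noncomputable def wordOp {d : ℕ} (S : Fin d → (FockSpace d →L[ℂ] FockSpace d))
    (α : FreeMonoid (Fin d)) : FockSpace d →L[ℂ] FockSpace d :=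
  (α.toList.map S).prod

theorem IsUnit.exists_polar {A : Type*} [CStarAlgebra A] [PartialOrder A] [StarOrderedRing A]
    {z : A} (hz : IsUnit z) :
    ∃ a w : A, 0 ≤ a ∧ IsUnit a ∧ star w * w = 1 ∧ w * star w = 1 ∧ z = a * w ∧
      ∀ p : A, IsSelfAdjoint p → Commute z p →
        Commute a p ∧ Commute w p ∧ (z * p = p → a * p = p) := by
  have hzz : 0 ≤ z * star z := mul_star_self_nonneg z
  set a := CFC.sqrt (z * star z)
  have ha0 : 0 ≤ a := CFC.sqrt_nonneg _
  have haa : a * a = z * star z := CFC.sqrt_mul_sqrt_self _ hzz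
  have hau : IsUnit a := (CFC.isUnit_sqrt_iff _ hzz).2 (hz.mul hz.star)
  have has : star a = a := (IsSelfAdjoint.of_nonneg ha0).star_eq
  obtain ⟨b, hab, hba⟩ := isUnit_iff_exists.1 hau
  have hbs : star b = b := by
    have h : star b * a = 1 := by rw [← has, ← star_mul, hab, star_one]
    calc star b = star b * (a * b) := by rw [hab, mul_one]
      _ = b := by rw [← mul_assoc, h, one_mul]
  have hbu : IsUnit b := isUnit_iff_exists.2 ⟨a, hba, hab⟩
  have hww : b * z * star (b * z) = 1 := by
    calc b * z * star (b * z) = b * (z * star z) * b := by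
          rw [star_mul, hbs]; simp only [mul_assoc]
      _ = (b * a) * (a * b) := by rw [← haa]; simp only [mul_assoc]
      _ = 1 := by rw [hab, hba, one_mul]
  have hbz : a * (b * z) = z := by rw [← mul_assoc, hab, one_mul]
  refine ⟨a, b * z, ha0, hau, ?_, hww, hbz.symm, ?_⟩
  · have hu : IsUnit (b * z) := hbu.mul hz
    apply hu.mul_left_cancel
    rw [← mul_assoc, hww, one_mul, mul_one]
  intro p hp hzp
  have hzp' : Commute (star z) p := by
    have := hzp.star_star
    rwa [hp.star_eq] at this
  have hap : Commute a p := (hzp.mul_left hzp').cfcₙ_nnreal NNReal.sqrt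
  have hbp : Commute b p := by
    calc b * p = b * p * (a * b) := by rw [hab, mul_one]
      _ = b * (a * p) * b := by rw [hap.eq]; simp only [mul_assoc]
      _ = p * b := by rw [← mul_assoc, hba, one_mul]
  refine ⟨hap, hbp.mul_left hzp, fun h => ?_⟩
  have hsz : star z * p = p := by
    rw [hzp'.eq]
    simpa [hp.star_eq] using congrArg star h
  have haap : a * a * p = p := by rw [haa, mul_assoc, hsz, h]
  have hu : IsUnit (a + 1) := by
    rw [add_comm]
    exact (isStrictlyPositive_one.add_nonneg ha0).isUnit
  apply hu.mul_left_cancel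
  rw [add_mul, add_mul, ← mul_assoc, haap, one_mul, one_mul, add_comm]

section Fock

variable {d : ℕ}

/-- The standard Hilbert basis of the Fock space. -/
def fockHilbertBasis (d : ℕ) : HilbertBasis (FreeMonoid (Fin d)) ℂ (FockSpace d) :=
  ⟨LinearIsometryEquiv.refl ℂ _⟩

theorem coe_fockHilbertBasis : ⇑(fockHilbertBasis d) = fockBasis d := by
  funext α
  rw [← HilbertBasis.repr_symm_single]
  simp only [fockBasis]
  rfl

theorem orthonormal_fockBasis : Orthonormal ℂ (fockBasis d) :=
  coe_fockHilbertBasis (d := d) ▸ (fockHilbertBasis d).orthonormal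

theorem inner_fockBasis (α β : FreeMonoid (Fin d)) :
    inner ℂ (fockBasis d α) (fockBasis d β) = if α = β then 1 else 0 :=
  orthonormal_iff_ite.1 orthonormal_fockBasis α β

theorem ContinuousLinearMap.mem_of_forall_fockBasis {M : Submodule ℂ (FockSpace d)}
    (hM : IsClosed (M : Set (FockSpace d))) (L : FockSpace d →L[ℂ] FockSpace d)
    (h : ∀ α, L (fockBasis d α) ∈ M) (x : FockSpace d) : L x ∈ M := by
  have hle : (Submodule.span ℂ (Set.range (fockBasis d))).topologicalClosure ≤
      M.comap (L : FockSpace d →ₗ[ℂ] FockSpace d) := by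
    refine Submodule.topologicalClosure_minimal _ ?_ (hM.preimage L.continuous)
    rw [Submodule.span_le]
    rintro _ ⟨α, rfl⟩
    exact h α
  have hd := (fockHilbertBasis d).dense_span
  rw [coe_fockHilbertBasis] at hd
  rw [hd] at hle
  exact hle trivial

theorem ContinuousLinearMap.ext_fockBasis {A B : FockSpace d →L[ℂ] FockSpace d}
    (h : ∀ α, A (fockBasis d α) = B (fockBasis d α)) : A = B := by
  ext1 x
  have := ContinuousLinearMap.mem_of_forall_fockBasis (M := ⊥) isClosed_singleton (A - B)
    (fun α => by simp [h α]) x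
  simpa [sub_eq_zero] using this

theorem ContinuousLinearMap.ext_inner_fockBasis {A B : FockSpace d →L[ℂ] FockSpace d}
    (h : ∀ α β, inner ℂ (fockBasis d α) (A (fockBasis d β)) =
      inner ℂ (fockBasis d α) (B (fockBasis d β))) : A = B := by
  refine ContinuousLinearMap.ext_fockBasis fun β => ?_
  apply (fockHilbertBasis d).repr.injective
  ext α
  rw [HilbertBasis.repr_apply_apply, HilbertBasis.repr_apply_apply, coe_fockHilbertBasis]
  exact h α β

open ContinuousLinearMap

theorem isSelfAdjoint_of_graded {P : ℕ → (FockSpace d →L[ℂ] FockSpace d)}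
    (hP : ∀ (k : ℕ) (α : FreeMonoid (Fin d)),
      P k (fockBasis d α) = if α.length = k then fockBasis d α else 0) (k : ℕ) :
    IsSelfAdjoint (P k) := by
  rw [isSelfAdjoint_iff']
  refine ContinuousLinearMap.ext_inner_fockBasis fun α β => ?_
  rw [adjoint_inner_right, hP, hP]
  by_cases h : α = β
  · subst h
    split_ifs <;> simp
  · split_ifs <;> simp [inner_fockBasis, h]

theorem adjoint_creation_mul_creation {S : Fin d → (FockSpace d →L[ℂ] FockSpace d)}
    (hS : ∀ (i : Fin d) (α : FreeMonoid (Fin d)),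
      S i (fockBasis d α) = fockBasis d (FreeMonoid.of i * α)) (i j : Fin d) :
    adjoint (S i) * S j = if i = j then 1 else 0 := by
  refine ContinuousLinearMap.ext_inner_fockBasis fun α β => ?_
  rw [mul_apply_eq_comp, adjoint_inner_right, hS, hS, inner_fockBasis]
  have hiff : FreeMonoid.of i * α = FreeMonoid.of j * β ↔ i = j ∧ α = β :=
    List.cons_eq_cons (a := i) (b := j) (l := α.toList) (l' := β.toList)
  by_cases hij : i = j
  · subst hij
    simp [inner_fockBasis, hiff]
  · simp [hiff, hij]

theorem projection_succ_mul_creation {S : Fin d → (FockSpace d →L[ℂ] FockSpace d)}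
    (hS : ∀ (i : Fin d) (α : FreeMonoid (Fin d)),
      S i (fockBasis d α) = fockBasis d (FreeMonoid.of i * α))
    {P : ℕ → (FockSpace d →L[ℂ] FockSpace d)}
    (hP : ∀ (k : ℕ) (α : FreeMonoid (Fin d)),
      P k (fockBasis d α) = if α.length = k then fockBasis d α else 0) (k : ℕ) (i : Fin d) :
    P (k + 1) * S i = S i * P k := by
  refine ContinuousLinearMap.ext_fockBasis fun α => ?_
  rw [mul_apply_eq_comp, mul_apply_eq_comp, hS, hP, hP, FreeMonoid.length_mul, FreeMonoid.length_of]
  by_cases h : α.length = k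
  · rw [if_pos h, if_pos (by omega), hS]
  · rw [if_neg h, if_neg (by omega), map_zero]

theorem projection_zero_mul_creation {S : Fin d → (FockSpace d →L[ℂ] FockSpace d)}
    (hS : ∀ (i : Fin d) (α : FreeMonoid (Fin d)),
      S i (fockBasis d α) = fockBasis d (FreeMonoid.of i * α))
    {P : ℕ → (FockSpace d →L[ℂ] FockSpace d)}
    (hP : ∀ (k : ℕ) (α : FreeMonoid (Fin d)),
      P k (fockBasis d α) = if α.length = k then fockBasis d α else 0) (i : Fin d) :
    P 0 * S i = 0 := by
  refine ContinuousLinearMap.ext_fockBasis fun α => ?_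
  rw [mul_apply_eq_comp, hS, hP, FreeMonoid.length_mul, FreeMonoid.length_of, if_neg (by omega)]
  simp

theorem wordOp_one (T : Fin d → (FockSpace d →L[ℂ] FockSpace d)) : wordOp T 1 = 1 := rfl

theorem wordOp_of_mul (T : Fin d → (FockSpace d →L[ℂ] FockSpace d)) (i : Fin d)
    (α : FreeMonoid (Fin d)) : wordOp T (FreeMonoid.of i * α) = T i * wordOp T α := by
  simp [wordOp]

theorem orthonormal_wordOp {T : Fin d → (FockSpace d →L[ℂ] FockSpace d)} {x : FockSpace d}
    (hT : ∀ i j, adjoint (T i) * T j = if i = j then 1 else 0)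
    (hx : ‖x‖ = 1) (hTx : ∀ i, adjoint (T i) x = 0) :
    Orthonormal ℂ fun α => wordOp T α x := by
  rw [orthonormal_iff_ite]
  intro α
  induction α using FreeMonoid.inductionOn' with
  | one =>
    intro β
    induction β using FreeMonoid.inductionOn' with
    | one => simp [wordOp_one, hx, inner_self_eq_norm_sq_to_K]
    | of_mul j β _ =>
      rw [wordOp_one, wordOp_of_mul, one_apply_eq_self, mul_apply_eq_comp,
        ← adjoint_inner_left, hTx, inner_zero_left, if_neg]
      intro h
      have := congrArg FreeMonoid.length h
      rw [FreeMonoid.length_mul, FreeMonoid.length_of, FreeMonoid.length_one] at this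
      omega
  | of_mul i α ih =>
    intro β
    induction β using FreeMonoid.inductionOn' with
    | one =>
      rw [wordOp_one, wordOp_of_mul, one_apply_eq_self, mul_apply_eq_comp,
        ← adjoint_inner_right, hTx, inner_zero_right, if_neg]
      intro h
      have := congrArg FreeMonoid.length h
      rw [FreeMonoid.length_mul, FreeMonoid.length_of, FreeMonoid.length_one] at this
      omega
    | of_mul j β _ =>
      have hiff : FreeMonoid.of i * α = FreeMonoid.of j * β ↔ i = j ∧ α = β :=
        List.cons_eq_cons (a := i) (b := j) (l := α.toList) (l' := β.toList)
      rw [wordOp_of_mul, wordOp_of_mul, mul_apply_eq_comp, mul_apply_eq_comp,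
        ← adjoint_inner_right, ← mul_apply_eq_comp, hT]
      by_cases hij : i = j
      · subst hij
        simp [hiff, ih β]
      · simp [hiff, hij]

theorem exists_unitary_of_wordOp {T : Fin d → (FockSpace d →L[ℂ] FockSpace d)} {x : FockSpace d}
    (ho : Orthonormal ℂ fun α => wordOp T α x)
    (hsp : ⊤ ≤ (Submodule.span ℂ (Set.range fun α => wordOp T α x)).topologicalClosure) :
    ∃ U : FockSpace d →L[ℂ] FockSpace d, adjoint U * U = 1 ∧ U * adjoint U = 1 ∧
      ∀ α, U (fockBasis d α) = wordOp T α x := by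
  let b := HilbertBasis.mk ho hsp
  let e : FockSpace d ≃ₗᵢ[ℂ] FockSpace d := b.repr.symm
  refine ⟨(e : FockSpace d →L[ℂ] FockSpace d), ?_, ?_, fun α => ?_⟩
  · rw [LinearIsometryEquiv.adjoint_eq_symm]
    ext1 y
    exact e.symm_apply_apply y
  · rw [LinearIsometryEquiv.adjoint_eq_symm]
    ext1 y
    exact e.apply_symm_apply y
  · have h := b.repr_symm_single α
    rw [HilbertBasis.coe_mk] at h
    exact h

theorem top_le_closure_span_wordOp {S : Fin d → (FockSpace d →L[ℂ] FockSpace d)}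
    (hS : ∀ (i : Fin d) (α : FreeMonoid (Fin d)),
      S i (fockBasis d α) = fockBasis d (FreeMonoid.of i * α))
    {P : ℕ → (FockSpace d →L[ℂ] FockSpace d)}
    (hP : ∀ (k : ℕ) (α : FreeMonoid (Fin d)),
      P k (fockBasis d α) = if α.length = k then fockBasis d α else 0)
    {W V : FockSpace d →L[ℂ] FockSpace d} (hWV : W * V = 1) (hWP : ∀ k, Commute W (P k)) :
    ⊤ ≤ (Submodule.span ℂ
      (Set.range fun α => wordOp (fun i => W * S i) α (fockBasis d 1))).topologicalClosure := by
  set M := (Submodule.span ℂ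
      (Set.range fun α => wordOp (fun i => W * S i) α (fockBasis d 1))).topologicalClosure
  have hMc : IsClosed (M : Set (FockSpace d)) := Submodule.isClosed_topologicalClosure _
  have hmem : ∀ α, wordOp (fun i => W * S i) α (fockBasis d 1) ∈ M := fun α =>
    Submodule.le_topologicalClosure _ (Submodule.subset_span ⟨α, rfl⟩)
  have hinv : ∀ i x, x ∈ M → W (S i x) ∈ M := by
    intro i x hx
    have hle : M ≤ M.comap ((W * S i : FockSpace d →L[ℂ] FockSpace d) :
        FockSpace d →ₗ[ℂ] FockSpace d) := by
      refine Submodule.topologicalClosure_minimal _ ?_ (hMc.preimage (W * S i).continuous)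
      rw [Submodule.span_le]
      rintro _ ⟨α, rfl⟩
      have h := hmem (FreeMonoid.of i * α)
      rw [wordOp_of_mul] at h
      exact h
    exact hle hx
  have hk : ∀ k α, FreeMonoid.length α = k → fockBasis d α ∈ M := by
    intro k
    induction k with
    | zero =>
      intro α hα
      rw [FreeMonoid.length_eq_zero] at hα
      subst hα
      exact hmem 1
    | succ k ih =>
      intro α hα
      have hα' : fockBasis d α = (W * P (k + 1)) (V (fockBasis d α)) := by
        rw [(hWP _).eq, mul_apply_eq_comp, ← mul_apply_eq_comp W V, hWV,
          one_apply_eq_self, hP, if_pos hα]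
      rw [hα']
      refine ContinuousLinearMap.mem_of_forall_fockBasis hMc _ (fun β => ?_) _
      rw [mul_apply_eq_comp, hP]
      split_ifs with hβ
      · induction β using FreeMonoid.inductionOn' with
        | one => simp at hβ
        | of_mul i β _ =>
          rw [FreeMonoid.length_mul, FreeMonoid.length_of] at hβ
          rw [← hS]
          exact hinv i _ (ih β (by omega))
      · simp
  intro x _
  simpa using ContinuousLinearMap.mem_of_forall_fockBasis hMc 1 (fun α => hk _ α rfl) x

theorem projection_wordOp {P : ℕ → (FockSpace d →L[ℂ] FockSpace d)}
    {T : Fin d → (FockSpace d →L[ℂ] FockSpace d)} {x : FockSpace d}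
    (hx : ∀ k, P k x = if k = 0 then x else 0) (h0 : ∀ i, P 0 * T i = 0)
    (hsucc : ∀ k i, P (k + 1) * T i = T i * P k) (k : ℕ) (α : FreeMonoid (Fin d)) :
    P k (wordOp T α x) = if α.length = k then wordOp T α x else 0 := by
  induction α using FreeMonoid.inductionOn' generalizing k with
  | one => simp [wordOp_one, hx, eq_comm]
  | of_mul i α ih =>
    rw [wordOp_of_mul, mul_apply_eq_comp, ← mul_apply_eq_comp (P k), FreeMonoid.length_mul,
      FreeMonoid.length_of]
    cases k with
    | zero => rw [h0, if_neg (by omega), zero_apply]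
    | succ k =>
      rw [hsucc, mul_apply_eq_comp, ih]
      by_cases h : α.length = k
      · rw [if_pos h, if_pos (by omega)]
      · rw [if_neg h, if_neg (by omega), map_zero]

end Fock

open ContinuousLinearMap in
theorem statement0 (d : ℕ) (hd : 1 ≤ d)
    (S : Fin d → (FockSpace d →L[ℂ] FockSpace d))
    (hS : ∀ (i : Fin d) (α : FreeMonoid (Fin d)),
      S i (fockBasis d α) = fockBasis d (FreeMonoid.of i * α))
    (P : ℕ → (FockSpace d →L[ℂ] FockSpace d))
    (hP : ∀ (k : ℕ) (α : FreeMonoid (Fin d)),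
      P k (fockBasis d α) = if α.length = k then fockBasis d α else 0)
    (Z : FockSpace d →L[ℂ] FockSpace d)
    (hZinv : IsUnit Z)
    (hZP : ∀ k : ℕ, Z * P k = P k * Z)
    (hZ0 : Z * P 0 = P 0) :
    ∃ U Z' : FockSpace d →L[ℂ] FockSpace d,
      adjoint U * U = 1 ∧ U * adjoint U = 1 ∧
      (∀ k : ℕ, U * P k = P k * U) ∧
      IsUnit Z' ∧ Z'.IsPositive ∧ (∀ k : ℕ, Z' * P k = P k * Z') ∧ Z' * P 0 = P 0 ∧
      ∀ i : Fin d, adjoint U * (Z * S i) * U = Z' * S i := by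
  obtain ⟨A, W, hA0, hAu, hW1, hW2, hZ, hAW⟩ := hZinv.exists_polar
  have hPs := isSelfAdjoint_of_graded hP
  have hAP : ∀ k, Commute A (P k) := fun k => (hAW _ (hPs k) (hZP k)).1
  have hWP : ∀ k, Commute W (P k) := fun k => (hAW _ (hPs k) (hZP k)).2.1
  have hA1 : A * P 0 = P 0 := (hAW _ (hPs 0) (hZP 0)).2.2 hZ0
  have hP1 : ∀ k, P k (fockBasis d 1) = if k = 0 then fockBasis d 1 else 0 := fun k => by
    simp [hP, eq_comm]
  have hT0 : ∀ i, P 0 * (W * S i) = 0 := fun i => by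
    rw [← mul_assoc, ← (hWP 0).eq, mul_assoc, projection_zero_mul_creation hS hP, mul_zero]
  have hTs : ∀ k i, P (k + 1) * (W * S i) = W * S i * P k := fun k i => by
    rw [← mul_assoc, ← (hWP _).eq, mul_assoc, projection_succ_mul_creation hS hP, mul_assoc]
  have hTT : ∀ i j, adjoint (W * S i) * (W * S j) = if i = j then 1 else 0 := fun i j => by
    rw [← adjoint_creation_mul_creation hS, ← star_eq_adjoint, ← star_eq_adjoint, star_mul,
      mul_assoc, ← mul_assoc (star W), hW1, one_mul]
  have hTx : ∀ i, adjoint (W * S i) (fockBasis d 1) = 0 := fun i => by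
    have h : adjoint (W * S i) * P 0 = 0 := by
      have := congrArg star (hT0 i)
      rwa [star_mul, (hPs 0).star_eq, star_zero] at this
    have h1 : P 0 (fockBasis d 1) = fockBasis d 1 := by simp [hP1]
    rw [← h1, ← mul_apply_eq_comp, h, zero_apply]
  obtain ⟨U, hU1, hU2, hUe⟩ := exists_unitary_of_wordOp
    (orthonormal_wordOp hTT (orthonormal_fockBasis.1 1) hTx)
    (top_le_closure_span_wordOp hS hP hW2 hWP)
  have hUP : ∀ k, Commute U (P k) := fun k => by
    refine ContinuousLinearMap.ext_fockBasis fun α => ?_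
    rw [mul_apply_eq_comp, mul_apply_eq_comp, hUe, projection_wordOp hP1 hT0 hTs, hP]
    split_ifs
    · exact hUe α
    · exact map_zero U
  have hUP' : ∀ k, Commute (adjoint U) (P k) := fun k => by
    have := (hUP k).star_star
    rwa [(hPs k).star_eq] at this
  have hUP0 : U * P 0 = P 0 := by
    refine ContinuousLinearMap.ext_fockBasis fun α => ?_
    rw [mul_apply_eq_comp, hP]
    split_ifs with h
    · rw [FreeMonoid.length_eq_zero] at h
      subst h
      rw [hUe, wordOp_one, one_apply_eq_self]
    · exact map_zero U
  have hUS : ∀ i, U * S i = W * S i * U := fun i => by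
    refine ContinuousLinearMap.ext_fockBasis fun α => ?_
    rw [mul_apply_eq_comp, mul_apply_eq_comp, hS, hUe, hUe, wordOp_of_mul, mul_apply_eq_comp]
  have hUu : IsUnit U := isUnit_iff_exists.2 ⟨adjoint U, hU2, hU1⟩
  have hUu' : IsUnit (adjoint U) := isUnit_iff_exists.2 ⟨U, hU1, hU2⟩
  refine ⟨U, adjoint U * A * U, hU1, hU2, hUP, (hUu'.mul hAu).mul hUu, ?_,
    fun k => ((hUP' k).mul_left (hAP k)).mul_left (hUP k), ?_, fun i => ?_⟩
  · rw [← ContinuousLinearMap.nonneg_iff_isPositive, ← star_eq_adjoint]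
    exact star_left_conjugate_nonneg hA0 U
  · calc adjoint U * A * U * P 0 = adjoint U * (A * (U * P 0)) := by simp only [mul_assoc]
      _ = adjoint U * (U * P 0) := by rw [hUP0, hA1]
      _ = P 0 := by rw [← mul_assoc, hU1, one_mul]
  · calc adjoint U * (Z * S i) * U = adjoint U * A * (W * S i * U) := by
          rw [hZ]; simp only [mul_assoc]
      _ = adjoint U * A * U * S i := by rw [← hUS]; simp only [mul_assoc]
end
end

section
/- Let Z be a weight operator satisfying Condition A(p) for some p ≥ 1. Then for all words α, β with |α| = |β|, the commutators S_α S_β* Z − Z S_α S_β* and S_α S_β* Z* − Z* S_α S_β* are compact operators. -/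
noncomputable section

open ContinuousLinearMap

theorem IsCompactOperator.adjoint_of_complex {E F : Type*} [NormedAddCommGroup E]
    [InnerProductSpace ℂ E] [CompleteSpace E] [NormedAddCommGroup F] [InnerProductSpace ℂ F]
    [CompleteSpace F] {T : E →L[ℂ] F} (hT : IsCompactOperator ⇑T) :
    IsCompactOperator ⇑(adjoint T) := by
  have hTA : IsCompactOperator ⇑(T ∘L adjoint T) := hT.comp_clm (adjoint T)
  have htb : TotallyBounded ((T ∘L adjoint T) '' Metric.closedBall 0 1) :=
    (IsCompactOperator.isCompact_closure_image_closedBall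
      (f := (T ∘L adjoint T : F →L[ℂ] F).toLinearMap) hTA 1).totallyBounded.subset subset_closure
  refine (isCompactOperator_iff_isCompact_closure_image_closedBall
    (adjoint T).toLinearMap one_pos).2 ?_
  refine TotallyBounded.isCompact_of_isClosed (TotallyBounded.closure ?_) isClosed_closure
  refine Metric.totallyBounded_iff.2 fun ε hε => ?_
  obtain ⟨t, hts, htf, hcov⟩ := Metric.finite_approx_of_totallyBounded htb (ε ^ 2 / 2) (by positivity)
  obtain ⟨u, hu, huf, rfl⟩ := Set.exists_subset_image_finite_and.1 ⟨t, hts, htf, rfl⟩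
  refine ⟨adjoint T '' u, huf.image _, ?_⟩
  rintro _ ⟨x, hx, rfl⟩
  obtain ⟨_, ⟨y, hy, rfl⟩, hxy⟩ := Set.mem_iUnion₂.1 (hcov ⟨x, hx, rfl⟩)
  refine Set.mem_iUnion₂.2 ⟨_, ⟨y, hy, rfl⟩, ?_⟩
  have hx1 : ‖x‖ ≤ 1 := by simpa using hx
  have hy1 : ‖y‖ ≤ 1 := by simpa using hu hy
  rw [Metric.mem_ball, dist_eq_norm, ← map_sub] at hxy
  change dist (adjoint T x) (adjoint T y) < ε
  rw [dist_eq_norm, ← map_sub]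
  have hsub : ‖x - y‖ ≤ 2 := (norm_sub_le x y).trans (by linarith)
  have hsq : ‖adjoint T (x - y)‖ ^ 2 ≤ ‖(T ∘L adjoint T) (x - y)‖ * ‖x - y‖ := by
    rw [← inner_self_eq_norm_sq (𝕜 := ℂ), adjoint_inner_right]
    exact (RCLike.re_le_norm _).trans (norm_inner_le_norm _ _)
  have hlt : ‖adjoint T (x - y)‖ ^ 2 < ε ^ 2 := by
    nlinarith [norm_nonneg ((T ∘L adjoint T) (x - y)), norm_nonneg (x - y)]
  exact lt_of_pow_lt_pow_left₀ 2 hε.le hlt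

theorem FreeMonoid.exists_mul_eq_of_length {ι : Type*} (α : FreeMonoid ι) (m n : ℕ)
    (h : α.length = m + n) :
    ∃ β γ : FreeMonoid ι, α = β * γ ∧ β.length = m ∧ γ.length = n :=
  ⟨ofList (α.toList.take m), ofList (α.toList.drop m), (List.take_append_drop m α.toList).symm,
    (List.length_take (l := α.toList)).trans (by change min m α.length = m; omega),
    (List.length_drop (l := α.toList)).trans (by change α.length - m = n; omega)⟩

section Fock

variable {d : ℕ}

theorem inner_fockBasis_left (a : FreeMonoid (Fin d)) (x : FockSpace d) :
    inner ℂ (fockBasis d a) x = x a := by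
  rw [fockBasis, lp.inner_single_left]
  simp

theorem fockBasis_apply (a b : FreeMonoid (Fin d)) :
    fockBasis d a b = if b = a then 1 else 0 := by
  rw [fockBasis, lp.single_apply, Pi.single_apply]

theorem fockSpace_clm_ext {f g : FockSpace d →L[ℂ] FockSpace d}
    (h : ∀ a, f (fockBasis d a) = g (fockBasis d a)) : f = g := by
  refine lp.ext_continuousLinearMap (by simp) fun a => ?_
  ext1
  exact h a

variable {S : Fin d → (FockSpace d →L[ℂ] FockSpace d)}

theorem wordOp_one_s7 : wordOp S 1 = 1 := rfl

theorem wordOp_of (i : Fin d) : wordOp S (FreeMonoid.of i) = S i := by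
  simp [wordOp]

theorem wordOp_mul (α β : FreeMonoid (Fin d)) :
    wordOp S (α * β) = wordOp S α * wordOp S β := by
  simp [wordOp]

theorem wordOp_fockBasis
    (hS : ∀ (i : Fin d) (α : FreeMonoid (Fin d)),
      S i (fockBasis d α) = fockBasis d (FreeMonoid.of i * α))
    (α β : FreeMonoid (Fin d)) : wordOp S α (fockBasis d β) = fockBasis d (α * β) := by
  induction α using FreeMonoid.inductionOn' with
  | one => simp [wordOp_one_s7]
  | of_mul i α ih =>
    rw [wordOp_mul, wordOp_of, mul_apply_eq_comp, ih, hS, mul_assoc]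

theorem adjoint_wordOp_apply
    (hS : ∀ (i : Fin d) (α : FreeMonoid (Fin d)),
      S i (fockBasis d α) = fockBasis d (FreeMonoid.of i * α))
    (β a : FreeMonoid (Fin d)) (x : FockSpace d) :
    adjoint (wordOp S β) x a = x (β * a) := by
  rw [← inner_fockBasis_left, adjoint_inner_right, wordOp_fockBasis hS, inner_fockBasis_left]

theorem adjoint_wordOp_mul_wordOp
    (hS : ∀ (i : Fin d) (α : FreeMonoid (Fin d)),
      S i (fockBasis d α) = fockBasis d (FreeMonoid.of i * α))
    {β γ : FreeMonoid (Fin d)} (h : β.length = γ.length) :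
    adjoint (wordOp S β) * wordOp S γ = if β = γ then 1 else 0 := by
  refine fockSpace_clm_ext fun b => lp.ext (funext fun a => ?_)
  rw [mul_apply_eq_comp, adjoint_wordOp_apply hS, wordOp_fockBasis hS, fockBasis_apply]
  have key : β * a = γ * b ↔ β = γ ∧ a = b :=
    ⟨fun e => List.append_inj e h, fun e => by rw [e.1, e.2]⟩
  by_cases hβ : β = γ
  · simp [hβ, fockBasis_apply]
  · simp [key, hβ]

theorem one_eq_sum_mul_adjoint_add
    (hS : ∀ (i : Fin d) (α : FreeMonoid (Fin d)),
      S i (fockBasis d α) = fockBasis d (FreeMonoid.of i * α)) :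
    (1 : FockSpace d →L[ℂ] FockSpace d) = ∑ i, S i * adjoint (S i) +
      (innerSL ℂ (fockBasis d 1)).smulRight (fockBasis d 1) := by
  refine fockSpace_clm_ext fun b => ?_
  have hadj (i : Fin d) (a : FreeMonoid (Fin d)) (x : FockSpace d) :
      adjoint (S i) x a = x (FreeMonoid.of i * a) := by
    rw [← wordOp_of (S := S) i, adjoint_wordOp_apply hS]
  cases b using FreeMonoid.casesOn with
  | one =>
    have h0 (i : Fin d) : adjoint (S i) (fockBasis d 1) = 0 := by
      refine lp.ext (funext fun a => ?_)
      rw [hadj, fockBasis_apply, if_neg]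
      · rfl
      · exact List.cons_ne_nil _ _
    have h2 : inner ℂ (fockBasis d 1) (fockBasis d 1) = 1 := by
      rw [inner_fockBasis_left, fockBasis_apply, if_pos rfl]
    simp [h0, h2, -inner_self_eq_norm_sq_to_K]
  | of_mul j c =>
    have h1 (i : Fin d) : adjoint (S i) (fockBasis d (FreeMonoid.of j * c)) =
        if i = j then fockBasis d c else 0 := by
      rw [← hS, ← mul_apply_eq_comp, ← wordOp_of (S := S) i, ← wordOp_of (S := S) j,
        adjoint_wordOp_mul_wordOp hS (by simp only [FreeMonoid.length_of])]
      by_cases hij : i = j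
      · simp [hij]
      · simp [hij, FreeMonoid.of_injective.eq_iff]
    have h2 : (1 : FreeMonoid (Fin d)) ≠ FreeMonoid.of j * c := (List.cons_ne_nil _ _).symm
    simp [h1, inner_fockBasis_left, fockBasis_apply, h2, apply_ite, hS]

theorem isCompactOperator_of_mul_wordOp
    (hS : ∀ (i : Fin d) (α : FreeMonoid (Fin d)),
      S i (fockBasis d α) = fockBasis d (FreeMonoid.of i * α))
    (r : ℕ) {T : FockSpace d →L[ℂ] FockSpace d}
    (hT : ∀ γ : FreeMonoid (Fin d), γ.length = r → IsCompactOperator ⇑(T * wordOp S γ)) :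
    IsCompactOperator ⇑T := by
  induction r with
  | zero => simpa [wordOp_one_s7] using hT 1 rfl
  | succ r ih =>
    refine ih fun γ hγ => ?_
    have hi (i : Fin d) : IsCompactOperator ⇑(T * wordOp S γ * (S i * adjoint (S i))) := by
      have := hT (γ * FreeMonoid.of i) (by simp [FreeMonoid.length_mul, hγ])
      rw [wordOp_mul, wordOp_of, ← mul_assoc] at this
      rw [← mul_assoc]
      exact this.comp_clm (adjoint (S i))
    rw [← mul_one (T * wordOp S γ), one_eq_sum_mul_adjoint_add hS, mul_add, Finset.mul_sum]
    refine IsCompactOperator.add ?_ ?_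
    · exact Submodule.sum_mem (compactOperator (RingHom.id ℂ) (FockSpace d) (FockSpace d))
        (fun i _ => hi i)
    · have : IsCompactOperator ⇑(innerSL ℂ (fockBasis d 1)) :=
        isCompactOperator_of_locallyCompactSpace_dom _
      exact this.clm_comp ((T * wordOp S γ) ∘L
        (ContinuousLinearMap.id ℂ ℂ).smulRight (fockBasis d 1))

theorem isCompactOperator_commutator_wordOp {Z : FockSpace d →L[ℂ] FockSpace d} {p : ℕ}
    (hAp : ∀ α : FreeMonoid (Fin d), α.length = p →
      IsCompactOperator ⇑(wordOp S α * Z - Z * wordOp S α))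
    (n : ℕ) (α : FreeMonoid (Fin d)) (hα : α.length = n * p) :
    IsCompactOperator ⇑(wordOp S α * Z - Z * wordOp S α) := by
  induction n generalizing α with
  | zero =>
    obtain rfl : α = 1 := FreeMonoid.length_eq_zero.1 (by simpa using hα)
    simpa [wordOp_one_s7] using isCompactOperator_zero
  | succ n ih =>
    obtain ⟨β, γ, rfl, hβ, hγ⟩ := FreeMonoid.exists_mul_eq_of_length α p (n * p) (by rw [hα]; ring)
    have heq : wordOp S (β * γ) * Z - Z * wordOp S (β * γ) =
        wordOp S β * (wordOp S γ * Z - Z * wordOp S γ) +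
          (wordOp S β * Z - Z * wordOp S β) * wordOp S γ := by
      rw [wordOp_mul]; noncomm_ring
    rw [heq]
    exact ((ih γ hγ).clm_comp (wordOp S β)).add ((hAp β hβ).comp_clm (wordOp S γ))

theorem isCompactOperator_commutator_mul_adjoint
    (hS : ∀ (i : Fin d) (α : FreeMonoid (Fin d)),
      S i (fockBasis d α) = fockBasis d (FreeMonoid.of i * α))
    {Z : FockSpace d →L[ℂ] FockSpace d} {p : ℕ} (hp : 1 ≤ p)
    (hAp : ∀ α : FreeMonoid (Fin d), α.length = p →
      IsCompactOperator ⇑(wordOp S α * Z - Z * wordOp S α))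
    {α β : FreeMonoid (Fin d)} (h : α.length = β.length) :
    IsCompactOperator
      ⇑(wordOp S α * adjoint (wordOp S β) * Z - Z * (wordOp S α * adjoint (wordOp S β))) := by
  refine isCompactOperator_of_mul_wordOp hS (β.length * p) fun γ hγ => ?_
  have hcomm := isCompactOperator_commutator_wordOp hAp
  obtain ⟨k, rfl⟩ := Nat.exists_eq_add_of_le hp
  obtain ⟨γ₁, γ₂, rfl, h₁, h₂⟩ :=
    FreeMonoid.exists_mul_eq_of_length γ β.length (β.length * k) (by rw [hγ]; ring)
  have hcγ := hcomm _ _ hγ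
  have hcα := hcomm β.length (α * γ₂) (by rw [FreeMonoid.length_mul, h, h₂]; ring)
  set A := wordOp S α
  set B := adjoint (wordOp S β)
  have hB : B * wordOp S (γ₁ * γ₂) = if β = γ₁ then wordOp S γ₂ else 0 := by
    rw [wordOp_mul, ← mul_assoc, adjoint_wordOp_mul_wordOp hS h₁.symm]
    split_ifs <;> simp
  have heq : (A * B * Z - Z * (A * B)) * wordOp S (γ₁ * γ₂) =
      (A * (B * wordOp S (γ₁ * γ₂)) * Z - Z * (A * (B * wordOp S (γ₁ * γ₂)))) -
        A * B * (wordOp S (γ₁ * γ₂) * Z - Z * wordOp S (γ₁ * γ₂)) := by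
    noncomm_ring
  rw [heq, hB]
  refine IsCompactOperator.sub ?_ (hcγ.clm_comp (A * B))
  split_ifs
  · rwa [wordOp_mul] at hcα
  · rw [mul_zero, zero_mul, mul_zero, sub_zero]
    exact isCompactOperator_zero

end Fock

open ContinuousLinearMap in
theorem statement7 (d : ℕ) (hd : 1 ≤ d)
    (S : Fin d → (FockSpace d →L[ℂ] FockSpace d))
    (hS : ∀ (i : Fin d) (α : FreeMonoid (Fin d)),
      S i (fockBasis d α) = fockBasis d (FreeMonoid.of i * α))
    (P : ℕ → (FockSpace d →L[ℂ] FockSpace d))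
    (hP : ∀ (k : ℕ) (α : FreeMonoid (Fin d)),
      P k (fockBasis d α) = if α.length = k then fockBasis d α else 0)
    (Z : FockSpace d →L[ℂ] FockSpace d)
    (hZinv : IsUnit Z)
    (hZP : ∀ k : ℕ, Z * P k = P k * Z)
    (hZ0 : Z * P 0 = P 0)
    (p : ℕ) (hp : 1 ≤ p)
    (hAp : ∀ α : FreeMonoid (Fin d), α.length = p →
      IsCompactOperator ⇑(wordOp S α * Z - Z * wordOp S α)) :
    ∀ α β : FreeMonoid (Fin d), α.length = β.length →
      IsCompactOperator
        ⇑(wordOp S α * adjoint (wordOp S β) * Z - Z * (wordOp S α * adjoint (wordOp S β))) ∧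
      IsCompactOperator
        ⇑(wordOp S α * adjoint (wordOp S β) * adjoint Z -
            adjoint Z * (wordOp S α * adjoint (wordOp S β))) := by
  intro α β h
  refine ⟨isCompactOperator_commutator_mul_adjoint hS hp hAp h, ?_⟩
  have hc := (isCompactOperator_commutator_mul_adjoint hS hp hAp h.symm).adjoint_of_complex.neg
  have heq : wordOp S α * adjoint (wordOp S β) * adjoint Z -
      adjoint Z * (wordOp S α * adjoint (wordOp S β)) =
      -adjoint (wordOp S β * adjoint (wordOp S α) * Z -
        Z * (wordOp S β * adjoint (wordOp S α))) := by
    simp only [← star_eq_adjoint, star_sub, star_mul, star_star]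
    noncomm_ring
  rw [heq]
  exact hc
end
end

section
/- Let d = 1, so H = ℓ²(ℕ) with orthonormal basis (e_k), S the unilateral shift (S e_k = e_{k+1}), and let Z ∈ B(H) be a bounded invertible operator with Z P_k = P_k Z for every k (P_k the rank-one projection onto ℂe_k) and Z P_0 = P_0. Let T be the smallest closed star-subalgebra of B(H) containing ZS. If n ≥ 1 and S^n Z − Z S^n is compact, then for every X ∈ T satisfying X P_k = P_k X for all k, the commutator S^n X − X S^n is compact. -/
noncomputable section

/-- The Fock space of `ℂ` (the case `d = 1`), modeled as `ℓ²(ℕ)`. -/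
abbrev FockSpace1 : Type := lp (fun _ : ℕ => ℂ) 2

/-- The standard basis vector `e_k` of `ℓ²(ℕ)`. -/
noncomputable def e1 (k : ℕ) : FockSpace1 := lp.single 2 k (1 : ℂ)

/-- **Schauder's theorem** for Hilbert spaces: the adjoint of a compact operator is compact. -/
theorem IsCompactOperator.adjoint {𝕜 E F : Type*} [RCLike 𝕜]
    [NormedAddCommGroup E] [InnerProductSpace 𝕜 E] [CompleteSpace E]
    [NormedAddCommGroup F] [InnerProductSpace 𝕜 F] [CompleteSpace F]
    {A : E →L[𝕜] F} (hA : IsCompactOperator A) :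
    IsCompactOperator (ContinuousLinearMap.adjoint A) := by
  set B := ContinuousLinearMap.adjoint A with hB
  have hAB : IsCompactOperator (A.comp B) := hA.comp_clm B
  have htb : TotallyBounded (A.comp B '' Metric.ball 0 1) :=
    ((hAB.isCompact_closure_image_ball (f := (A.comp B).toLinearMap) 1).totallyBounded).subset
      subset_closure
  have key (z : F) : ‖B z‖ ^ 2 ≤ ‖A.comp B z‖ * ‖z‖ := by
    have h := norm_inner_le_norm (𝕜 := 𝕜) (A (B z)) z
    rwa [← ContinuousLinearMap.adjoint_inner_right A, ← hB, inner_self_eq_norm_sq_to_K,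
      norm_pow, RCLike.norm_ofReal, abs_norm] at h
  refine (isCompactOperator_iff_isCompact_closure_image_ball B.toLinearMap one_pos).2 ?_
  refine (TotallyBounded.closure ?_).isCompact_of_isClosed isClosed_closure
  refine Metric.totallyBounded_iff.2 fun ε hε => ?_
  obtain ⟨s, hs, hsfin, hcover⟩ := Set.exists_subset_image_finite_and.1
    (Metric.finite_approx_of_totallyBounded htb (ε ^ 2 / 2) (by positivity))
  refine ⟨B '' s, hsfin.image _, ?_⟩
  rintro _ ⟨x, hx, rfl⟩
  have hx' := hcover ⟨x, hx, rfl⟩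
  simp only [Set.mem_iUnion, Set.exists_mem_image, exists_prop] at hx' ⊢
  obtain ⟨y, hy, hxy⟩ := hx'
  refine ⟨y, hy, ?_⟩
  have hy' := hs hy
  rw [mem_ball_zero_iff] at hx hy'
  rw [Metric.mem_ball, dist_eq_norm, ← map_sub] at hxy
  change dist (B x) (B y) < ε
  rw [dist_eq_norm, ← map_sub]
  have hle : ‖x - y‖ ≤ 2 := (norm_sub_le x y).trans (by linarith)
  refine lt_of_pow_lt_pow_left₀ 2 hε.le ((key (x - y)).trans_lt ?_)
  calc ‖A.comp B (x - y)‖ * ‖x - y‖ ≤ ‖A.comp B (x - y)‖ * 2 := by gcongr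
    _ < ε ^ 2 := by linarith

section Calkin

variable {E : Type*} [NormedAddCommGroup E] [InnerProductSpace ℂ E]

theorem IsCompactOperator.mul_left {A : E →L[ℂ] E} (hA : IsCompactOperator A) (B : E →L[ℂ] E) :
    IsCompactOperator ⇑(B * A) :=
  hA.clm_comp B

theorem IsCompactOperator.mul_right {A : E →L[ℂ] E} (hA : IsCompactOperator A) (B : E →L[ℂ] E) :
    IsCompactOperator ⇑(A * B) :=
  hA.comp_clm B

/-- If `V` is a left inverse of `U` and a right inverse modulo the compact operators, then every
operator commuting with `U` modulo the compact operators also commutes with `V` modulo them. -/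
theorem isCompactOperator_commutator_of_essential_inverse {U V X : E →L[ℂ] E} (hVU : V * U = 1)
    (hUV : IsCompactOperator ⇑(1 - U * V)) (hX : IsCompactOperator ⇑(U * X - X * U)) :
    IsCompactOperator ⇑(X * V - V * X) := by
  have h : X * V - V * X = V * (U * X - X * U) * V - V * X * (1 - U * V) := by
    have h' : V * (U * X - X * U) * V = (V * U) * X * V - V * X * U * V := by noncomm_ring
    rw [h', hVU]
    noncomm_ring
  rw [h]
  exact ((hX.mul_left V).mul_right V).sub (hUV.mul_left (V * X))

theorem isCompactOperator_one_sub_pow_mul_pow {U V : E →L[ℂ] E}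
    (hUV : IsCompactOperator ⇑(1 - U * V)) (n : ℕ) :
    IsCompactOperator ⇑(1 - U ^ n * V ^ n) := by
  induction n with
  | zero => simpa using isCompactOperator_zero
  | succ n ih =>
    have h : 1 - U ^ (n + 1) * V ^ (n + 1) = (1 - U * V) + U * (1 - U ^ n * V ^ n) * V := by
      rw [pow_succ' U, pow_succ V]
      simp only [mul_sub, sub_mul, mul_assoc, mul_one]
      abel
    rw [h]
    exact hUV.add ((ih.mul_left U).mul_right V)

/-- The operators commuting modulo the compact operators with an isometry `U` that is unitary
modulo the compact operators. -/
def essentialCommutant [CompleteSpace E] (U : E →L[ℂ] E) (hU : star U * U = 1)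
    (hU' : IsCompactOperator ⇑(1 - U * star U)) : StarSubalgebra ℂ (E →L[ℂ] E) where
  carrier := {X | IsCompactOperator ⇑(U * X - X * U)}
  mul_mem' {X Y} hX hY := by
    have h : U * (X * Y) - X * Y * U = (U * X - X * U) * Y + X * (U * Y - Y * U) := by
      noncomm_ring
    simp only [Set.mem_ofPred_eq, h]
    exact (IsCompactOperator.mul_right hX Y).add (IsCompactOperator.mul_left hY X)
  add_mem' {X Y} hX hY := by
    have h : U * (X + Y) - (X + Y) * U = (U * X - X * U) + (U * Y - Y * U) := by
      noncomm_ring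
    simp only [Set.mem_ofPred_eq, h]
    exact IsCompactOperator.add hX hY
  algebraMap_mem' r := by
    simp only [Set.mem_ofPred_eq, ← Algebra.commutes r U, sub_self]
    exact isCompactOperator_zero
  star_mem' {X} hX := by
    have h := (isCompactOperator_commutator_of_essential_inverse hU hU' hX).adjoint
    have h' : ContinuousLinearMap.adjoint (X * star U - star U * X)
        = U * star X - star X * U := by
      rw [← ContinuousLinearMap.star_eq_adjoint]
      simp
    rwa [h'] at h

theorem isClosed_essentialCommutant [CompleteSpace E] (U : E →L[ℂ] E) (hU : star U * U = 1)
    (hU' : IsCompactOperator ⇑(1 - U * star U)) :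
    IsClosed (essentialCommutant U hU hU' : Set (E →L[ℂ] E)) := by
  have hcont : Continuous fun X : E →L[ℂ] E => U * X - X * U := by fun_prop
  exact (isClosed_setOfPred_isCompactOperator (σ₁₂ := RingHom.id ℂ)
    (M₁ := E) (M₂ := E)).preimage hcont

end Calkin

theorem FockSpace1.clm_ext {A B : FockSpace1 →L[ℂ] FockSpace1} (h : ∀ k, A (e1 k) = B (e1 k)) :
    A = B := by
  refine lp.ext_continuousLinearMap (by simp) fun k => ?_
  refine ContinuousLinearMap.ext_ring ?_
  simpa [e1] using h k

theorem inner_e1_left (k : ℕ) (v : FockSpace1) : inner ℂ (e1 k) v = v k := by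
  rw [e1, lp.inner_single_left]
  simp

theorem inner_e1_e1 (j k : ℕ) : inner ℂ (e1 j) (e1 k) = if j = k then (1 : ℂ) else 0 := by
  rw [inner_e1_left, e1]
  simp [Pi.single_apply]

theorem star_shift_mul_shift {S : FockSpace1 →L[ℂ] FockSpace1}
    (hS : ∀ k : ℕ, S (e1 k) = e1 (k + 1)) : star S * S = 1 := by
  refine FockSpace1.clm_ext fun k => lp.ext (funext fun j => ?_)
  rw [← inner_e1_left, ← inner_e1_left, mul_apply_eq_comp,
    ContinuousLinearMap.star_eq_adjoint, ContinuousLinearMap.adjoint_inner_right, hS, hS,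
    one_apply_eq_self, inner_e1_e1, inner_e1_e1]
  simp

theorem isCompactOperator_one_sub_shift_mul_star_shift {S : FockSpace1 →L[ℂ] FockSpace1}
    (hS : ∀ k : ℕ, S (e1 k) = e1 (k + 1)) : IsCompactOperator ⇑(1 - S * star S) := by
  set Q := 1 - S * star S with hQ
  have hQS : Q * S = 0 := by
    rw [hQ, sub_mul, mul_assoc, star_shift_mul_shift hS]
    simp
  have h : Q = (ContinuousLinearMap.toSpanSingleton ℂ (Q (e1 0))).comp (innerSL ℂ (e1 0)) := by
    refine FockSpace1.clm_ext fun k => ?_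
    cases k with
    | zero =>
      rw [ContinuousLinearMap.comp_apply, innerSL_apply_apply, inner_e1_e1]
      simp
    | succ k =>
      rw [← hS k, ← mul_apply_eq_comp, hQS]
      simp [hS, inner_e1_e1]
  rw [h]
  have hφ : IsCompactOperator ⇑(innerSL ℂ (e1 0)) :=
    isCompactOperator_of_locallyCompactSpace_dom (innerSL ℂ (e1 0) : FockSpace1 →L[ℂ] ℂ)
  exact hφ.clm_comp
    (ContinuousLinearMap.toSpanSingleton ℂ (Q (e1 0)))

open ContinuousLinearMap in
theorem statement13
    (S : FockSpace1 →L[ℂ] FockSpace1)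
    (hS : ∀ k : ℕ, S (e1 k) = e1 (k + 1))
    (P : ℕ → (FockSpace1 →L[ℂ] FockSpace1))
    (hP : ∀ k m : ℕ, P k (e1 m) = if m = k then e1 m else 0)
    (Z : FockSpace1 →L[ℂ] FockSpace1)
    (hZinv : IsUnit Z)
    (hZP : ∀ k : ℕ, Z * P k = P k * Z)
    (hZ0 : Z * P 0 = P 0)
    (n : ℕ) (hn : 1 ≤ n)
    (hc : IsCompactOperator ⇑(S ^ n * Z - Z * S ^ n)) :
    ∀ X ∈ (StarAlgebra.adjoin ℂ ({Z * S} : Set (FockSpace1 →L[ℂ] FockSpace1))).topologicalClosure,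
      (∀ k : ℕ, X * P k = P k * X) →
        IsCompactOperator ⇑(S ^ n * X - X * S ^ n) := by
  intro X hX _
  have hU : star (S ^ n) * S ^ n = 1 := by
    rw [star_pow]
    exact pow_mul_pow_eq_one n (star_shift_mul_shift hS)
  have hU' : IsCompactOperator ⇑(1 - S ^ n * star (S ^ n)) := by
    rw [star_pow]
    exact isCompactOperator_one_sub_pow_mul_pow
      (isCompactOperator_one_sub_shift_mul_star_shift hS) n
  have hZS : Z * S ∈ essentialCommutant (S ^ n) hU hU' := by
    have h : S ^ n * (Z * S) - Z * S * S ^ n = (S ^ n * Z - Z * S ^ n) * S := by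
      rw [mul_assoc Z S, (Commute.self_pow S n).eq, sub_mul, mul_assoc, mul_assoc]
    change IsCompactOperator ⇑(S ^ n * (Z * S) - Z * S * S ^ n)
    rw [h]
    exact hc.mul_right S
  exact StarSubalgebra.topologicalClosure_minimal
    (StarAlgebra.adjoin_le (Set.singleton_subset_iff.2 hZS))
    (isClosed_essentialCommutant (S ^ n) hU hU') hX
end
end
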